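/- Let F be a field, σ : F → F a field automorphism of finite order m, and T ⊆ ℤ. If h, h' ∈ F^m both have their m entries linearly independent over F^σ (so each is an F^σ-basis of F), then the codes C_(σ,h,T) and C_(σ,h',T), of length n = m, are F^σ-linearly rank equivalent. -/

import Mathlib

/-- The fixed subfield of a field automorphism `σ : F ≃+* F`. -/
def fixedField {F : Type*} [Field F] (σ : F ≃+* F) : Subfield F where
  carrier := {x | σ x = x}
  mul_mem' := by
    intro a b ha hb
    simp only [Set.mem_setOf_eq] at *
    rw [map_mul, ha, hb]
  one_mem' := by simp only [Set.mem_setOf_eq, map_one]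
  add_mem' := by
    intro a b ha hb
    simp only [Set.mem_setOf_eq] at *
    rw [map_add, ha, hb]
  zero_mem' := by simp only [Set.mem_setOf_eq, map_zero]
  neg_mem' := by
    intro a ha
    simp only [Set.mem_setOf_eq] at *
    rw [map_neg, ha]
  inv_mem' := by
    intro a ha
    simp only [Set.mem_setOf_eq] at *
    rw [map_inv₀, ha]

/-- The code `C_(σ,h,T)`: vectors whose `i`-th syndromes with respect to `h` vanish
for all `i ∈ T`. -/
def code {F : Type*} [Field F] {ι : Type*} [Fintype ι] (σ : F ≃+* F) (h : ι → F)
    (T : Set ℤ) : Set (ι → F) :=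
  {v : ι → F | ∀ i ∈ T, ∑ j, v j * (σ ^ i) (h j) = 0}

theorem fixedField_eq_fixedPoints_zpowers {F : Type*} [Field F] (σ : F ≃+* F) :
    fixedField σ = FixedPoints.subfield (Subgroup.zpowers σ) F := by
  ext a
  refine ⟨fun ha g => ?_, fun ha => ha ⟨σ, Subgroup.mem_zpowers σ⟩⟩
  exact Subgroup.zpowers_le.2 (MulAction.mem_stabilizer_iff.2 (show σ • a = a from ha)) g.2

/-- Artin's theorem for the cyclic group generated by an automorphism of finite order. -/
theorem finrank_fixedField {F : Type*} [Field F] (σ : F ≃+* F) (hσ : 0 < orderOf σ) :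
    Module.finrank (fixedField σ) F = orderOf σ := by
  have : Finite (Subgroup.zpowers σ) := finite_zpowers.2 (orderOf_pos_iff.1 hσ)
  have := Fintype.ofFinite (Subgroup.zpowers σ)
  rw [fixedField_eq_fixedPoints_zpowers, FixedPoints.finrank_eq_card,
    ← Nat.card_eq_fintype_card, Nat.card_zpowers]

theorem zpow_apply_of_mem_fixedField {F : Type*} [Field F] {σ : F ≃+* F} {a : F}
    (ha : a ∈ fixedField σ) (i : ℤ) : (σ ^ i) a = a := by
  rw [fixedField_eq_fixedPoints_zpowers] at ha
  exact ha ⟨σ ^ i, i, rfl⟩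

/-- Changing the defining vector by a matrix over the fixed field moves that matrix to the
codewords. -/
theorem mem_code_iff_vecMul_mem_code {F : Type*} [Field F] {ι κ : Type*} [Fintype ι] [Fintype κ]
    {σ : F ≃+* F} {h : ι → F} {h' : κ → F} {P : Matrix ι κ F} (hP : ∀ i j, P i j ∈ fixedField σ)
    (hPh : P.mulVec h' = h) (T : Set ℤ) (v : ι → F) :
    v ∈ code σ h T ↔ Matrix.vecMul v P ∈ code σ h' T := by
  refine forall₂_congr fun i _ => ?_
  have key : (fun j => (σ ^ i) (h j)) = P.mulVec fun k => (σ ^ i) (h' k) := by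
    ext j
    simp [← hPh, Matrix.mulVec, dotProduct, map_sum, zpow_apply_of_mem_fixedField (hP _ _)]
  change v ⬝ᵥ (fun j => (σ ^ i) (h j)) = 0 ↔ Matrix.vecMul v P ⬝ᵥ (fun k => (σ ^ i) (h' k)) = 0
  rw [key, Matrix.dotProduct_mulVec]

/-- For length `n = m` (the order of `σ`), all codes `C_(σ,h,T)` with the same `σ` and `T`
are `F^σ`-linearly rank equivalent. -/
theorem rank_equivalence_full_length {F : Type*} [Field F]
    (σ : F ≃+* F) (m : ℕ) (hm0 : 0 < m) (hord : orderOf σ = m)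
    (T : Set ℤ) (h h' : Fin m → F)
    (hh : LinearIndependent (fixedField σ) h)
    (hh' : LinearIndependent (fixedField σ) h') :
    ∃ P : Matrix (Fin m) (Fin m) F, (∀ i j, P i j ∈ fixedField σ) ∧ IsUnit P ∧
      code σ h' T = (fun c => Matrix.vecMul c P) '' code σ h T := by
  have : Nonempty (Fin m) := ⟨⟨0, hm0⟩⟩
  have hcard : Fintype.card (Fin m) = Module.finrank (fixedField σ) F := by
    rw [finrank_fixedField σ (hord ▸ hm0), hord, Fintype.card_fin]
  let b := basisOfLinearIndependentOfCardEqFinrank hh hcard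
  let b' := basisOfLinearIndependentOfCardEqFinrank hh' hcard
  let A : Matrix (Fin m) (Fin m) (fixedField σ) := (b'.toMatrix b).transpose
  let P : Matrix (Fin m) (Fin m) F := A.map (fixedField σ).subtype
  have hA : IsUnit A := by
    have := b'.invertibleToMatrix b
    exact (Matrix.isUnit_transpose _).2 (isUnit_of_invertible _)
  have hPF : ∀ i j, P i j ∈ fixedField σ := fun i j => (A i j).2
  have hPu : IsUnit P := hA.map (fixedField σ).subtype.mapMatrix
  have hPh : P.mulVec h' = h := by
    ext j
    have hb := b'.sum_repr (b j)
    simpa [b, b', P, A, Matrix.mulVec, dotProduct, Module.Basis.toMatrix_apply,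
      Subfield.smul_def] using hb
  refine ⟨P, hPF, hPu, Set.Subset.antisymm (fun w hw => ?_) ?_⟩
  · obtain ⟨v, rfl⟩ := Matrix.vecMul_surjective_iff_isUnit.2 hPu w
    exact ⟨v, (mem_code_iff_vecMul_mem_code hPF hPh T v).2 hw, rfl⟩
  · rintro _ ⟨v, hv, rfl⟩
    exact (mem_code_iff_vecMul_mem_code hPF hPh T v).1 hv
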